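/- arXiv:1606.03872 — 2 statements merged into one kernel-verified Lean document; each statement's English description precedes it below -/
import Mathlib

section
/- For every integer n ≥ 4, there exists an edge-coloring of the complete graph K_n with 2 colors such that for every 3-subset S of vertices there exist 2 internally disjoint S-trees, each of which is properly colored (no two adjacent edges share a color); that is, px_{3,2}(K_n) = 2. -/
open SimpleGraph

/-- `T` is an `S`-tree in `G`: a subtree of `G` containing all vertices of `S`. -/
def IsSTree {V : Type*} (G : SimpleGraph V) (S : Set V) (T : G.Subgraph) : Prop :=
  T.coe.IsTree ∧ S ⊆ T.verts

/-- A family of subgraphs is internally disjoint with respect to `S`: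
pairwise edge-disjoint, and pairwise vertex intersection exactly `S`. -/
def InternallyDisjoint {V ι : Type*} {G : SimpleGraph V} (S : Set V)
    (T : ι → G.Subgraph) : Prop :=
  ∀ i j, i ≠ j → (T i).edgeSet ∩ (T j).edgeSet = ∅ ∧ (T i).verts ∩ (T j).verts = S

/-- No two adjacent edges of the subgraph `T` receive the same color under `c`. -/
def ProperSubgraph {V α : Type*} {G : SimpleGraph V} (c : Sym2 V → α) (T : G.Subgraph) : Prop :=
  ∀ u v w, T.Adj u v → T.Adj u w → v ≠ w → c s(u, v) ≠ c s(u, w)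

/-- `c` is a `(k,ℓ)`-proper coloring of `G`: every `k`-subset `S` of vertices is connected by
`ℓ` internally disjoint proper `S`-trees. -/
def IsProperColoring {V α : Type*} (G : SimpleGraph V) (k ℓ : ℕ) (c : Sym2 V → α) : Prop :=
  ∀ S : Finset V, S.card = k →
    ∃ T : Fin ℓ → G.Subgraph,
      (∀ i, IsSTree G (S : Set V) (T i) ∧ ProperSubgraph c (T i)) ∧
      InternallyDisjoint (S : Set V) T

/-- The `(k,ℓ)`-proper index of `G` is at most `m`. -/
def pxLE {V : Type*} (G : SimpleGraph V) (k ℓ m : ℕ) : Prop :=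
  ∃ c : Sym2 V → Fin m, IsProperColoring G k ℓ c

/-- The `(k,ℓ)`-proper index of `G` equals `2`. -/
def pxEq2 {V : Type*} (G : SimpleGraph V) (k ℓ : ℕ) : Prop :=
  pxLE G k ℓ 2 ∧ ¬ pxLE G k ℓ 1

namespace PxProof

/-! ### Path graphs are trees -/

theorem pathGraph_isTree (k : ℕ) : (pathGraph (k + 1)).IsTree := by
  refine ⟨pathGraph_connected k, ?_⟩
  have key : ∀ i j : Fin (k + 1), i.val + 1 = j.val →
      ¬ ((pathGraph (k + 1)) \ fromEdgeSet {s(i, j)}).Reachable i j := by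
    intro i j hij hr
    have inv : ∀ u v : Fin (k + 1),
        ((pathGraph (k + 1)) \ fromEdgeSet {s(i, j)}).Walk u v → (u ≤ i ↔ v ≤ i) := by
      intro u v w
      induction w with
      | nil => rfl
      | cons h p ih =>
        rw [← ih]
        simp only [sdiff_adj, pathGraph_adj, fromEdgeSet_adj, Set.mem_singleton_iff,
          Sym2.eq_iff, Fin.ext_iff, ne_eq, Fin.le_def] at h ⊢
        omega
    obtain ⟨w⟩ := hr
    have := inv _ _ w
    simp only [Fin.le_def] at this
    omega
  rw [isAcyclic_iff_forall_adj_isBridge]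
  intro i j h
  rw [isBridge_iff]
  rw [pathGraph_adj] at h
  rcases h with h | h
  · exact key i j h
  · have := key j i h
    rw [Sym2.eq_swap]
    exact fun hr => this hr.symm

/-- Consecutive indices. -/
def Nxt (i j : ℕ) : Prop := i + 1 = j ∨ j + 1 = i

instance (i j : ℕ) : Decidable (Nxt i j) := inferInstanceAs (Decidable (_ ∨ _))

/-- The path in the complete graph running through the values of an injective function. -/
def pathSub {V : Type*} {k : ℕ} (f : Fin k → V) (hf : Function.Injective f) :
    (⊤ : SimpleGraph V).Subgraph where
  verts := Set.range f
  Adj u v := ∃ i j : Fin k, Nxt i j ∧ f i = u ∧ f j = v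
  adj_sub := by
    rintro u v ⟨i, j, h, rfl, rfl⟩
    rw [top_adj]
    intro e
    have := hf e
    subst this
    simp [Nxt] at h
  edge_vert := by
    rintro u v ⟨i, j, h, rfl, rfl⟩
    exact ⟨i, rfl⟩
  symm := ⟨by
    rintro u v ⟨i, j, h, rfl, rfl⟩
    exact ⟨j, i, h.symm, rfl, rfl⟩⟩

theorem pathSub_isTree {V : Type*} {k : ℕ} (hk : k ≠ 0) (f : Fin k → V)
    (hf : Function.Injective f) : (pathSub f hf).coe.IsTree := by
  obtain ⟨m, rfl⟩ := Nat.exists_eq_succ_of_ne_zero hk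
  let e : pathGraph (m + 1) ≃g (pathSub f hf).coe :=
    { toEquiv := Equiv.ofInjective f hf
      map_rel_iff' := by
        intro i j
        rw [pathGraph_adj]
        constructor
        · rintro ⟨i', j', h, hi, hj⟩
          have h1 : i' = i := hf hi
          have h2 : j' = j := hf hj
          subst h1 h2
          exact h
        · intro h
          exact ⟨i, j, h, rfl, rfl⟩ }
  exact e.isTree_iff.mp (pathGraph_isTree m)

/-- Two paths `f`, `g` witnessing the required property for the triple `a, b, d`. -/
def Wit {V : Type*} (c : V → V → Fin 2) (a b d : V) {k l : ℕ} (f : Fin k → V) (g : Fin l → V) :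
    Prop :=
  (∀ i j, f i = f j → i = j) ∧ (∀ i j, g i = g j → i = j) ∧
  ((∃ i, f i = a) ∧ (∃ i, f i = b) ∧ (∃ i, f i = d)) ∧
  ((∃ i, g i = a) ∧ (∃ i, g i = b) ∧ (∃ i, g i = d)) ∧
  (∀ i j, f i = g j → f i = a ∨ f i = b ∨ f i = d) ∧
  (∀ i j : Fin k, Nxt i j → ∀ r : Fin k, Nxt i r → j ≠ r → c (f i) (f j) ≠ c (f i) (f r)) ∧
  (∀ i j : Fin l, Nxt i j → ∀ r : Fin l, Nxt i r → j ≠ r → c (g i) (g j) ≠ c (g i) (g r)) ∧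
  (∀ i j : Fin k, Nxt i j → ∀ r s : Fin l, Nxt r s → ¬ (f i = g r ∧ f j = g s))

set_option synthInstance.maxSize 2000 in
set_option synthInstance.maxHeartbeats 400000 in
instance {V : Type*} [DecidableEq V] (c : V → V → Fin 2) (a b d : V) {k l : ℕ}
    (f : Fin k → V) (g : Fin l → V) : Decidable (Wit c a b d f g) := by
  unfold Wit; infer_instance

theorem Wit.trees {V : Type*} [DecidableEq V] {c : V → V → Fin 2} {C : Sym2 V → Fin 2}
    (hC : ∀ x y, C s(x, y) = c x y) {a b d : V} {k l : ℕ}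
    {f : Fin k → V} {g : Fin l → V} (h : Wit c a b d f g) :
    ∃ T : Fin 2 → (⊤ : SimpleGraph V).Subgraph,
      (∀ i, IsSTree ⊤ (({a, b, d} : Finset V) : Set V) (T i) ∧ ProperSubgraph C (T i)) ∧
      InternallyDisjoint (({a, b, d} : Finset V) : Set V) T := by
  obtain ⟨hf, hg, ⟨fa, fb, fd⟩, ⟨ga, gb, gd⟩, hv, pf, pg, he⟩ := h
  have hf' : Function.Injective f := fun i j => hf i j
  have hg' : Function.Injective g := fun i j => hg i j
  have gen : ∀ {m : ℕ} (p : Fin m → V) (hp : Function.Injective p),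
      (∃ i, p i = a) → (∃ i, p i = b) → (∃ i, p i = d) →
      (∀ i j : Fin m, Nxt i j → ∀ r : Fin m, Nxt i r → j ≠ r →
        c (p i) (p j) ≠ c (p i) (p r)) →
      IsSTree ⊤ (({a, b, d} : Finset V) : Set V) (pathSub p hp) ∧
        ProperSubgraph C (pathSub p hp) := by
    intro m p hp ha hb hd hpr
    refine ⟨⟨pathSub_isTree ?_ p hp, ?_⟩, ?_⟩
    · rintro rfl
      exact ha.choose.elim0
    · intro x hx
      simp only [Finset.coe_insert, Finset.coe_singleton, Set.mem_insert_iff,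
        Set.mem_singleton_iff] at hx
      rcases hx with rfl | rfl | rfl
      exacts [ha, hb, hd]
    · rintro u v w ⟨i, j, hij, rfl, rfl⟩ ⟨i', r, hir, hi, rfl⟩ hne
      have := hp hi
      subst this
      rw [hC, hC]
      exact hpr _ _ hij _ hir (fun h => hne (by rw [h]))
  have hedge : (pathSub f hf').edgeSet ∩ (pathSub g hg').edgeSet = ∅ := by
    ext e
    induction e using Sym2.ind with
    | _ x y =>
      simp only [Set.mem_inter_iff, Subgraph.mem_edgeSet, Set.mem_empty_iff_false, iff_false]
      rintro ⟨⟨i, j, hij, rfl, rfl⟩, ⟨r, s, hrs, h1, h2⟩⟩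
      exact he i j hij r s hrs ⟨h1.symm, h2.symm⟩
  have hvert : (pathSub f hf').verts ∩ (pathSub g hg').verts
      = (({a, b, d} : Finset V) : Set V) := by
    ext x
    simp only [Finset.coe_insert, Finset.coe_singleton, Set.mem_insert_iff,
        Set.mem_singleton_iff]
    constructor
    · rintro ⟨⟨i, rfl⟩, ⟨j, hj⟩⟩
      exact hv i j hj.symm
    · rintro (rfl | rfl | rfl)
      exacts [⟨fa, ga⟩, ⟨fb, gb⟩, ⟨fd, gd⟩]
  refine ⟨![pathSub f hf', pathSub g hg'], ?_, ?_⟩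
  · intro i
    fin_cases i
    · exact gen f hf' fa fb fd pf
    · exact gen g hg' ga gb gd pg
  · intro i j hij
    fin_cases i <;> fin_cases j
    · exact absurd rfl hij
    · exact ⟨hedge, hvert⟩
    · constructor
      · exact (Set.inter_comm _ _).trans hedge
      · exact (Set.inter_comm _ _).trans hvert
    · exact absurd rfl hij

/-! ### The coloring -/

/-- The second color class is the path `0 3 2 1` together with a clique on the vertices `≥ 4`. -/
def col (i j : ℕ) : Fin 2 :=
  if (4 ≤ i ∧ 4 ≤ j) ∨ (i = 0 ∧ j = 3) ∨ (i = 3 ∧ j = 0) ∨ (i = 1 ∧ j = 2) ∨ (i = 2 ∧ j = 1)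
    ∨ (i = 2 ∧ j = 3) ∨ (i = 3 ∧ j = 2) then 1 else 0

theorem col_symm (i j : ℕ) : col i j = col j i := by
  unfold col
  congr 1
  apply propext
  omega

theorem col_map (φ : ℕ → ℕ) (h1 : ∀ x, x < 4 → φ x = x) (h2 : ∀ x, 4 ≤ x → 4 ≤ φ x)
    (x y : ℕ) : col (φ x) (φ y) = col x y := by
  unfold col
  congr 1
  apply propext
  have a1 := h1 x
  have a2 := h2 x
  have b1 := h1 y
  have b2 := h2 y
  omega

/-- The two paths for each triple. -/
def tbl : ℕ → ℕ → ℕ → List ℕ × List ℕ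
  | 0, 1, 2 => ([0, 1, 2], [0, 2, 3, 1])
  | 0, 1, 3 => ([1, 0, 3], [0, 2, 1, 3])
  | 0, 1, 4 => ([0, 2, 1, 4], [1, 0, 3, 4])
  | 0, 1, 5 => ([0, 1, 2, 5], [0, 4, 5, 1])
  | 0, 1, 6 => ([0, 1, 2, 6], [0, 4, 6, 1])
  | 0, 2, 3 => ([0, 2, 3], [0, 3, 1, 2])
  | 0, 2, 4 => ([0, 1, 2, 4], [0, 2, 3, 4])
  | 0, 2, 5 => ([0, 1, 2, 5], [0, 2, 3, 5])
  | 0, 2, 6 => ([0, 1, 2, 6], [0, 2, 3, 6])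
  | 0, 3, 4 => ([3, 0, 4], [0, 2, 3, 4])
  | 0, 3, 5 => ([3, 0, 5], [0, 2, 3, 5])
  | 0, 3, 6 => ([3, 0, 6], [0, 2, 3, 6])
  | 0, 4, 5 => ([0, 5, 4], [4, 0, 3, 5])
  | 0, 4, 6 => ([0, 6, 4], [4, 0, 3, 6])
  | 0, 5, 6 => ([0, 6, 5], [5, 0, 3, 6])
  | 1, 2, 3 => ([1, 3, 2], [1, 2, 0, 3])
  | 1, 2, 4 => ([2, 1, 4], [1, 3, 2, 4])
  | 1, 2, 5 => ([2, 1, 5], [1, 3, 2, 5])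
  | 1, 2, 6 => ([2, 1, 6], [1, 3, 2, 6])
  | 1, 3, 4 => ([1, 0, 3, 4], [1, 3, 2, 4])
  | 1, 3, 5 => ([1, 0, 3, 5], [1, 3, 2, 5])
  | 1, 3, 6 => ([1, 0, 3, 6], [1, 3, 2, 6])
  | 1, 4, 5 => ([1, 5, 4], [4, 1, 2, 5])
  | 1, 4, 6 => ([1, 6, 4], [4, 1, 2, 6])
  | 1, 5, 6 => ([1, 6, 5], [5, 1, 2, 6])
  | 2, 3, 4 => ([3, 2, 4], [2, 0, 3, 4])
  | 2, 3, 5 => ([3, 2, 5], [2, 0, 3, 5])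
  | 2, 3, 6 => ([3, 2, 6], [2, 0, 3, 6])
  | 2, 4, 5 => ([2, 4, 5], [4, 1, 2, 5])
  | 2, 4, 6 => ([2, 4, 6], [4, 1, 2, 6])
  | 2, 5, 6 => ([2, 5, 6], [5, 1, 2, 6])
  | 3, 4, 5 => ([3, 4, 5], [4, 0, 3, 5])
  | 3, 4, 6 => ([3, 4, 6], [4, 0, 3, 6])
  | 3, 5, 6 => ([3, 5, 6], [5, 0, 3, 6])
  | 4, 5, 6 => ([4, 1, 2, 5, 6], [4, 5, 0, 3, 6])
  | _, _, _ => ([], [])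

theorem tbl_spec : ∀ d < 7, ∀ b < d, ∀ a < b,
    Wit col a b d (fun i => (tbl a b d).fst.get i) (fun i => (tbl a b d).snd.get i) ∧
    (∀ i, (tbl a b d).fst.get i < max 4 (d + 1)) ∧ (∀ i, (tbl a b d).snd.get i < max 4 (d + 1)) := by
  decide +kernel

theorem exists_wit (n : ℕ) (hn : 4 ≤ n) (a b d : ℕ) (hab : a < b) (hbd : b < d) (hd : d < n) :
    ∃ (k l : ℕ) (f : Fin k → Fin n) (g : Fin l → Fin n),
      Wit (fun x y : Fin n => col x y) ⟨a, by omega⟩ ⟨b, by omega⟩ ⟨d, hd⟩ f g := by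
  obtain ⟨φ, a', b', d', h1, h2, hab', hbd', hd', ea, eb, ed, hlt, hinj⟩ :
      ∃ (φ : ℕ → ℕ) (a' b' d' : ℕ), (∀ x, x < 4 → φ x = x) ∧ (∀ x, 4 ≤ x → 4 ≤ φ x) ∧
        a' < b' ∧ b' < d' ∧ d' < 7 ∧ φ a' = a ∧ φ b' = b ∧ φ d' = d ∧
        (∀ x, x < max 4 (d' + 1) → φ x < n) ∧
        (∀ x y, x < max 4 (d' + 1) → y < max 4 (d' + 1) → φ x = φ y → x = y) := by
    by_cases c1 : d < 4
    · exact ⟨id, a, b, d, by simp, by simp, hab, hbd, by omega, rfl, rfl, rfl,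
        by intro x hx; simp only [id]; omega, by intro x y _ _ h; exact h⟩
    by_cases c2 : b < 4
    · refine ⟨fun x => if x < 4 then x else d, a, b, 4, ?_, ?_, ?_, ?_, ?_, ?_, ?_, ?_, ?_, ?_⟩
        <;> grind
    by_cases c3 : a < 4
    · refine ⟨fun x => if x < 4 then x else if x = 4 then b else d, a, 4, 5,
        ?_, ?_, ?_, ?_, ?_, ?_, ?_, ?_, ?_, ?_⟩ <;> grind
    · refine ⟨fun x => if x < 4 then x else if x = 4 then a else if x = 5 then b else d, 4, 5, 6,
        ?_, ?_, ?_, ?_, ?_, ?_, ?_, ?_, ?_, ?_⟩ <;> grind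
  obtain ⟨hw, hf, hg⟩ := tbl_spec d' hd' b' hbd' a' hab'
  generalize (tbl a' b' d').fst = L at hw hf
  generalize (tbl a' b' d').snd = R at hw hg
  refine ⟨_, _, fun i => ⟨φ (L.get i), hlt _ (hf i)⟩, fun i => ⟨φ (R.get i), hlt _ (hg i)⟩, ?_⟩
  obtain ⟨w1, w2, ⟨fa, fb, fd⟩, ⟨ga, gb, gd⟩, w5, w6, w7, w8⟩ := hw
  subst ea eb ed
  simp only [Wit, Fin.mk.injEq, col_map φ h1 h2]
  refine ⟨?_, ?_, ⟨?_, ?_, ?_⟩, ⟨?_, ?_, ?_⟩, ?_, w6, w7, ?_⟩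
  · exact fun i j h => w1 i j (hinj _ _ (hf i) (hf j) h)
  · exact fun i j h => w2 i j (hinj _ _ (hg i) (hg j) h)
  · exact fa.imp fun i h => congrArg φ h
  · exact fb.imp fun i h => congrArg φ h
  · exact fd.imp fun i h => congrArg φ h
  · exact ga.imp fun i h => congrArg φ h
  · exact gb.imp fun i h => congrArg φ h
  · exact gd.imp fun i h => congrArg φ h
  · intro i j h
    rcases w5 i j (hinj _ _ (hf i) (hg j) h) with h | h | h
    · exact Or.inl (congrArg φ h)
    · exact Or.inr (Or.inl (congrArg φ h))
    · exact Or.inr (Or.inr (congrArg φ h))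
  · rintro i j hij r s hrs ⟨e1, e2⟩
    exact w8 i j hij r s hrs ⟨hinj _ _ (hf i) (hg r) e1, hinj _ _ (hf j) (hg s) e2⟩

theorem upper (n : ℕ) (hn : 4 ≤ n) : pxLE (⊤ : SimpleGraph (Fin n)) 3 2 2 := by
  let C : Sym2 (Fin n) → Fin 2 :=
    Sym2.lift ⟨fun x y : Fin n => col x y, fun x y => col_symm x y⟩
  have hC : ∀ x y : Fin n, C s(x, y) = col x y := fun x y => rfl
  have main : ∀ x y z : Fin n, x < y → y < z → ∀ S : Finset (Fin n), S = {x, y, z} →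
      ∃ T : Fin 2 → (⊤ : SimpleGraph (Fin n)).Subgraph,
      (∀ i, IsSTree ⊤ (S : Set (Fin n)) (T i) ∧ ProperSubgraph C (T i)) ∧
      InternallyDisjoint (S : Set (Fin n)) T := by
    rintro x y z hxy hyz S rfl
    obtain ⟨k, l, f, g, h⟩ := exists_wit n hn x y z hxy hyz z.2
    exact h.trees hC
  refine ⟨C, fun S hS => ?_⟩
  obtain ⟨x, y, z, hxy, hxz, hyz, rfl⟩ := Finset.card_eq_three.mp hS
  rcases lt_or_gt_of_ne hxy with h1 | h1 <;> rcases lt_or_gt_of_ne hxz with h2 | h2 <;>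
    rcases lt_or_gt_of_ne hyz with h3 | h3
  · exact main x y z h1 h3 _ rfl
  · exact main x z y h2 h3 _ (by ext t; simp; tauto)
  · exact absurd (h1.trans h3) (not_lt.mpr h2.le)
  · exact main z x y h2 h1 _ (by ext t; simp; tauto)
  · exact main y x z h1 h2 _ (by ext t; simp; tauto)
  · exact absurd (h2.trans h3) (not_lt.mpr h1.le)
  · exact main y z x h3 h2 _ (by ext t; simp; tauto)
  · exact main z y x h3 h1 _ (by ext t; simp; tauto)

theorem lower (n : ℕ) (hn : 4 ≤ n) : ¬ pxLE (⊤ : SimpleGraph (Fin n)) 3 2 1 := by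
  rintro ⟨c, hc⟩
  let x : Fin n := ⟨0, by omega⟩
  let y : Fin n := ⟨1, by omega⟩
  let z : Fin n := ⟨2, by omega⟩
  obtain ⟨T, hT, -⟩ := hc {x, y, z} (by
    rw [Finset.card_eq_three]
    exact ⟨x, y, z, by simp [x, y], by simp [x, z], by simp [y, z], rfl⟩)
  obtain ⟨⟨ht, hS⟩, hp⟩ := hT 0
  have hx : x ∈ (T 0).verts := hS (by simp)
  have hy : y ∈ (T 0).verts := hS (by simp)
  have hz : z ∈ (T 0).verts := hS (by simp)
  have uniq : ∀ u v w, (T 0).Adj u v → (T 0).Adj u w → v = w := by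
    intro u v w h1 h2
    by_contra hne
    exact hp u v w h1 h2 hne (Subsingleton.elim _ _)
  have inv : ∀ p q : (T 0).verts, (T 0).Adj p q → ∀ u v : (T 0).verts, (T 0).coe.Walk u v →
      (u = p ∨ u = q) → (v = p ∨ v = q) := by
    intro p q hpq u v w
    induction w with
    | nil => exact id
    | cons h w ih =>
      intro hu
      apply ih
      rcases hu with rfl | rfl
      · exact Or.inr (Subtype.ext (uniq _ _ _ h hpq))
      · exact Or.inl (Subtype.ext (uniq _ _ _ h hpq.symm))
  have hpre := ht.connected.preconnected
  obtain ⟨w⟩ := hpre ⟨x, hx⟩ ⟨y, hy⟩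
  obtain ⟨w'⟩ := hpre ⟨x, hx⟩ ⟨z, hz⟩
  have nb : ∀ u v : (T 0).verts, (T 0).coe.Walk u v → u ≠ v → ∃ q, (T 0).coe.Adj u q := by
    intro u v w hne
    cases w with
    | nil => exact absurd rfl hne
    | cons h _ => exact ⟨_, h⟩
  have hxy : (⟨y, hy⟩ : (T 0).verts) ≠ ⟨x, hx⟩ := by simp [x, y]
  have hxz : (⟨z, hz⟩ : (T 0).verts) ≠ ⟨x, hx⟩ := by simp [x, z]
  obtain ⟨q, h⟩ := nb _ _ w hxy.symm
  have e3 := (inv _ _ h _ _ w (Or.inl rfl)).resolve_left hxy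
  have e4 := (inv _ _ h _ _ w' (Or.inl rfl)).resolve_left hxz
  have := e3.trans e4.symm
  simp [y, z] at this

end PxProof

/-- For every `n ≥ 4`, `px_{3,2}(K_n) = 2`. -/
theorem px_3_2_complete (n : ℕ) (hn : 4 ≤ n) :
    pxEq2 (⊤ : SimpleGraph (Fin n)) 3 2 :=
  ⟨PxProof.upper n hn, PxProof.lower n hn⟩
end

section
/- For every integer n ≥ 4, px_{n-1,2}(K_n) = 2: there is a 2-edge-coloring of K_n such that every set S of n−1 vertices is connected by two internally disjoint proper S-trees, and no 1-coloring suffices. -/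
open SimpleGraph

/-- The path graph is a tree. -/
lemma pathGraph_isTree_aux (k : ℕ) : (pathGraph (k + 1)).IsTree := by
  rw [isTree_iff_connected_and_card]
  refine ⟨pathGraph_connected k, ?_⟩
  have hE : (pathGraph (k + 1)).edgeSet =
      Set.range (fun i : Fin k => s(i.castSucc, i.succ)) := by
    ext e
    induction e using Sym2.ind with
    | _ u v =>
      simp only [mem_edgeSet, pathGraph_adj, Set.mem_range, Sym2.eq_iff, Fin.ext_iff,
        Fin.val_castSucc, Fin.val_succ]
      constructor
      · rintro (h | h)
        · exact ⟨⟨u, by omega⟩, by simp; omega⟩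
        · exact ⟨⟨v, by omega⟩, by simp; omega⟩
      · rintro ⟨i, h | h⟩ <;> omega
  rw [hE, Nat.card_range_of_injective]
  · simp
  · intro i j h
    simp only [Sym2.eq_iff, Fin.ext_iff, Fin.val_castSucc, Fin.val_succ] at h
    ext
    omega

/-- The subgraph of the complete graph formed by the path `p 0, p 1, …, p k`. -/
def pathSub {V : Type*} (p : ℕ → V) (k : ℕ) (hp : ∀ i j, i ≤ k → j ≤ k → p i = p j → i = j) :
    (⊤ : SimpleGraph V).Subgraph where
  verts := {x | ∃ i, i ≤ k ∧ p i = x}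
  Adj u v := ∃ i, i + 1 ≤ k ∧ s(u, v) = s(p i, p (i + 1))
  adj_sub := by
    rintro u v ⟨i, hi, h⟩
    have := hp i (i + 1) (by omega) hi
    rw [Sym2.eq_iff] at h
    rw [top_adj]
    rintro rfl
    grind
  edge_vert := by
    rintro u v ⟨i, hi, h⟩
    rw [Sym2.eq_iff] at h
    rcases h with h | h
    · exact ⟨i, by omega, h.1.symm⟩
    · exact ⟨i + 1, by omega, h.1.symm⟩
  symm := by
    constructor
    rintro u v ⟨i, hi, h⟩
    exact ⟨i, hi, by rw [Sym2.eq_swap, h]⟩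

lemma pathSub_isTree {V : Type*} (p : ℕ → V) (k : ℕ)
    (hp : ∀ i j, i ≤ k → j ≤ k → p i = p j → i = j) : (pathSub p k hp).coe.IsTree := by
  let F : Fin (k + 1) → (pathSub p k hp).verts := fun i => ⟨p i, i, by omega, rfl⟩
  have hF : Function.Bijective F := by
    constructor
    · intro i j h
      have h' : p i = p j := congrArg Subtype.val h
      ext
      exact hp _ _ (by omega) (by omega) h'
    · rintro ⟨x, i, hi, rfl⟩
      exact ⟨⟨i, by omega⟩, rfl⟩
  let e : pathGraph (k + 1) ≃g (pathSub p k hp).coe :=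
    { toEquiv := Equiv.ofBijective F hF
      map_rel_iff' := by
        intro a b
        simp only [Equiv.ofBijective_apply, Subgraph.coe_adj, pathGraph_adj]
        change (∃ i, i + 1 ≤ k ∧ s(p a, p b) = s(p i, p (i + 1))) ↔ _
        constructor
        · rintro ⟨i, hi, h⟩
          rw [Sym2.eq_iff] at h
          rcases h with ⟨h1, h2⟩ | ⟨h1, h2⟩
          · have := hp _ _ (by omega) (by omega) h1
            have := hp _ _ (by omega) (by omega) h2
            omega
          · have := hp _ _ (by omega) (by omega) h1
            have := hp _ _ (by omega) (by omega) h2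
            omega
        · rintro (h | h)
          · exact ⟨a, by omega, by rw [h]⟩
          · exact ⟨b, by omega, by rw [h, Sym2.eq_swap]⟩ }
  exact e.isTree_iff.1 (pathGraph_isTree_aux k)

lemma pathSub_proper {V α : Type*} (p : ℕ → V) (k : ℕ)
    (hp : ∀ i j, i ≤ k → j ≤ k → p i = p j → i = j) (c : Sym2 V → α)
    (hc : ∀ i, i + 2 ≤ k → c s(p i, p (i + 1)) ≠ c s(p (i + 1), p (i + 2))) :
    ProperSubgraph c (pathSub p k hp) := by
  rintro u v w ⟨i, hi, h⟩ ⟨j, hj, h'⟩ hvw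
  rw [h, h']
  rw [Sym2.eq_iff] at h h'
  have key : i + 1 = j ∨ j + 1 = i := by
    rcases h with ⟨h1, h2⟩ | ⟨h1, h2⟩ <;> rcases h' with ⟨h3, h4⟩ | ⟨h3, h4⟩
    · have := hp i j (by omega) (by omega) (h1.symm.trans h3)
      subst this
      exact absurd (h2.trans h4.symm) hvw
    · have := hp i (j + 1) (by omega) (by omega) (h1.symm.trans h3)
      omega
    · have := hp (i + 1) j (by omega) (by omega) (h1.symm.trans h3)
      omega
    · have := hp (i + 1) (j + 1) (by omega) (by omega) (h1.symm.trans h3)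
      have : i = j := by omega
      subst this
      exact absurd (h2.trans h4.symm) hvw
  rcases key with rfl | rfl
  · exact hc i (by omega)
  · exact (hc j (by omega)).symm

/-- Data of two edge-disjoint alternating paths, one spanning the complement of `v` and the other
one spanning at least the complement of `v`. -/
def GoodAt {V α : Type*} (c : Sym2 V → α) (v : V) : Prop :=
  ∃ (p q : ℕ → V) (k l : ℕ),
    (∀ i j, i ≤ k → j ≤ k → p i = p j → i = j) ∧
    (∀ i j, i ≤ l → j ≤ l → q i = q j → i = j) ∧
    (∀ i, i + 2 ≤ k → c s(p i, p (i + 1)) ≠ c s(p (i + 1), p (i + 2))) ∧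
    (∀ i, i + 2 ≤ l → c s(q i, q (i + 1)) ≠ c s(q (i + 1), q (i + 2))) ∧
    (∀ x, (∃ i, i ≤ k ∧ p i = x) ↔ x ≠ v) ∧
    (∀ x, x ≠ v → ∃ i, i ≤ l ∧ q i = x) ∧
    (∀ i j, i + 1 ≤ k → j + 1 ≤ l → s(p i, p (i + 1)) ≠ s(q j, q (j + 1)))

lemma proper_of_goodAt {n : ℕ} (hn : 1 ≤ n) {α : Type*} (c : Sym2 (Fin n) → α)
    (h : ∀ v, GoodAt c v) : IsProperColoring (⊤ : SimpleGraph (Fin n)) (n - 1) 2 c := by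
  intro S hS
  have hcompl : Sᶜ.card = 1 := by
    rw [Finset.card_compl, hS, Fintype.card_fin]; omega
  obtain ⟨v, hv⟩ := Finset.card_eq_one.1 hcompl
  have hmem : ∀ x, x ∈ S ↔ x ≠ v := by
    intro x
    have : x ∈ Sᶜ ↔ x = v := by rw [hv]; simp
    rw [Finset.mem_compl] at this
    tauto
  obtain ⟨p, q, k, l, hp, hq, hcp, hcq, hpv, hqv, hd⟩ := h v
  have hpS : (pathSub p k hp).verts = (S : Set (Fin n)) := by
    ext x
    rw [Finset.mem_coe, hmem]
    exact hpv x
  have hqS : (S : Set (Fin n)) ⊆ (pathSub q l hq).verts := by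
    intro x hx
    rw [Finset.mem_coe, hmem] at hx
    exact hqv x hx
  have hE : (pathSub p k hp).edgeSet ∩ (pathSub q l hq).edgeSet = ∅ := by
    ext e
    induction e using Sym2.ind with
    | _ a b =>
      simp only [Set.mem_inter_iff, Subgraph.mem_edgeSet, Set.mem_empty_iff_false, iff_false]
      rintro ⟨⟨i, hi, h1⟩, ⟨j, hj, h2⟩⟩
      exact hd i j hi hj (h1.symm.trans h2)
  refine ⟨![pathSub p k hp, pathSub q l hq], ?_, ?_⟩
  · intro i
    fin_cases i
    · exact ⟨⟨pathSub_isTree p k hp, hpS.ge⟩, pathSub_proper p k hp c hcp⟩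
    · exact ⟨⟨pathSub_isTree q l hq, hqS⟩, pathSub_proper q l hq c hcq⟩
  · intro i j hij
    fin_cases i <;> fin_cases j
    · exact absurd rfl hij
    · refine ⟨hE, ?_⟩
      change (pathSub p k hp).verts ∩ (pathSub q l hq).verts = _
      rw [hpS, Set.inter_eq_left]
      exact hqS
    · refine ⟨by rw [Set.inter_comm]; exact hE, ?_⟩
      change (pathSub q l hq).verts ∩ (pathSub p k hp).verts = _
      rw [hpS, Set.inter_eq_right]
      exact hqS
    · exact absurd rfl hij

/-- One color never suffices. -/
lemma not_pxLE_one (n : ℕ) (hn : 4 ≤ n) : ¬ pxLE (⊤ : SimpleGraph (Fin n)) (n - 1) 2 1 := by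
  rintro ⟨c, hc⟩
  obtain ⟨T, hT, -⟩ := hc (Finset.univ.erase ⟨3, by omega⟩) (by simp)
  obtain ⟨⟨htree, hS⟩, hprop⟩ := hT 0
  have hone : ∀ u v w, (T 0).Adj u v → (T 0).Adj u w → v = w := by
    intro u v w h1 h2
    by_contra h
    exact hprop u v w h1 h2 h (Subsingleton.elim _ _)
  have hin : ∀ i (h : i < 3), (⟨i, by omega⟩ : Fin n) ∈ (T 0).verts := by
    intro i h
    apply hS
    simp [Fin.ext_iff]
    omega
  have key : ∀ x y : (T 0).verts, (T 0).coe.Reachable x y →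
      x = y ∨ (T 0).Adj (x : Fin n) (y : Fin n) := by
    rintro x y ⟨w⟩
    induction w with
    | nil => exact Or.inl rfl
    | @cons a b d hab w ih =>
      have hab' : (T 0).Adj (a : Fin n) (b : Fin n) := hab
      rcases ih with rfl | h
      · exact Or.inr hab'
      · left
        exact Subtype.ext (hone b a d hab'.symm h)
  have h1 := key ⟨_, hin 0 (by omega)⟩ ⟨_, hin 1 (by omega)⟩ (htree.connected.preconnected _ _)
  have h2 := key ⟨_, hin 0 (by omega)⟩ ⟨_, hin 2 (by omega)⟩ (htree.connected.preconnected _ _)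
  simp only [Subtype.mk.injEq, Fin.mk.injEq] at h1 h2
  have := hone _ _ _ (h1.resolve_left (by omega)) (h2.resolve_left (by omega))
  simp [Fin.ext_iff] at this

lemma par_mod (m : ℕ) (hm2 : m % 2 = 0) (i j : ℕ) (h : i % m = j % m) : i % 2 = j % 2 := by
  obtain ⟨t, rfl⟩ : 2 ∣ m := by omega
  have := congrArg (· % 2) h
  simpa [Nat.mod_mul_right_mod] using this

/-- A coloring alternating along two edge-disjoint even cycles, with an extra set `A` of
edges in color `0`. -/
lemma exists_coloring {V : Type*} (m : ℕ) (hm : 6 ≤ m) (hm2 : m % 2 = 0) (f g : ℕ → V)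
    (hf : ∀ i j, f i = f j ↔ i % m = j % m) (hg : ∀ i j, g i = g j ↔ i % m = j % m)
    (hd : ∀ i j, s(f i, f (i + 1)) ≠ s(g j, g (j + 1))) (A : Set (Sym2 V))
    (hAf : ∀ i, s(f i, f (i + 1)) ∉ A) (hAg : ∀ i, s(g i, g (i + 1)) ∉ A) :
    ∃ c : Sym2 V → Fin 2, (∀ i, c s(f i, f (i + 1)) = 0 ↔ i % 2 = 0) ∧
      (∀ i, c s(g i, g (i + 1)) = 0 ↔ i % 2 = 0) ∧
      (∀ e, (∀ i, e ≠ s(f i, f (i + 1))) → (∀ i, e ≠ s(g i, g (i + 1))) →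
        (c e = 0 ↔ e ∈ A)) := by
  classical
  have hpar := par_mod m hm2
  have hcyc : ∀ f : ℕ → V, (∀ i j, f i = f j ↔ i % m = j % m) → ∀ i j,
      s(f i, f (i + 1)) = s(f j, f (j + 1)) → i % 2 = j % 2 := by
    intro f hf i j h
    rw [Sym2.eq_iff] at h
    simp only [hf] at h
    rcases h with ⟨h, -⟩ | ⟨h1, h2⟩
    · exact hpar _ _ h
    · exfalso
      have h3 : (j + 2) % m = j % m := by
        rw [← h2, Nat.add_mod i, h1, ← Nat.add_mod]
      have h4 := (Nat.ModEq.add_left_cancel' (c := j) (n := m) (a := 2) (b := 0) h3)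
      unfold Nat.ModEq at h4
      rw [Nat.mod_eq_of_lt (by omega), Nat.zero_mod] at h4
      omega
  refine ⟨fun e => if (∃ i, i % 2 = 0 ∧ e = s(f i, f (i + 1))) ∨
    (∃ i, i % 2 = 0 ∧ e = s(g i, g (i + 1))) ∨ e ∈ A then 0 else 1, ?_, ?_, ?_⟩
  · intro i
    simp only [ite_eq_left_iff, one_ne_zero, imp_false, not_not]
    constructor
    · rintro (⟨j, hj, h⟩ | ⟨j, hj, h⟩ | h)
      · rw [hcyc f hf i j h, hj]
      · exact absurd h (hd i j)
      · exact absurd h (hAf i)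
    · intro h
      exact Or.inl ⟨i, h, rfl⟩
  · intro i
    simp only [ite_eq_left_iff, one_ne_zero, imp_false, not_not]
    constructor
    · rintro (⟨j, hj, h⟩ | ⟨j, hj, h⟩ | h)
      · exact absurd h.symm (hd j i)
      · rw [hcyc g hg i j h, hj]
      · exact absurd h (hAg i)
    · intro h
      exact Or.inr (Or.inl ⟨i, h, rfl⟩)
  · intro e h1 h2
    simp only [ite_eq_left_iff, one_ne_zero, imp_false, not_not]
    constructor
    · rintro (⟨j, -, h⟩ | ⟨j, -, h⟩ | h)
      · exact absurd h (h1 j)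
      · exact absurd h (h2 j)
      · exact h
    · exact fun h => Or.inr (Or.inr h)

/-- Position-to-vertex map of the second cycle. -/
def gmap (m i : ℕ) : ℕ := if 2 * (i % m) < m then 2 * (i % m) else
  if 2 * (i % m) = m then 1 else 2 * (m - i % m) + 1

lemma gmap_lt (m i : ℕ) (hm : 6 ≤ m) (hm2 : m % 2 = 0) : gmap m i < m := by
  have := Nat.mod_lt i (show m > 0 by omega)
  unfold gmap
  split_ifs <;> omega

lemma gmap_eq_iff (m i j : ℕ) (hm : 6 ≤ m) (hm2 : m % 2 = 0) :
    gmap m i = gmap m j ↔ i % m = j % m := by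
  have := Nat.mod_lt i (show m > 0 by omega)
  have := Nat.mod_lt j (show m > 0 by omega)
  unfold gmap
  split_ifs <;> omega

lemma succ_mod_cases (m i : ℕ) (hm : 6 ≤ m) :
    (i % m + 1 < m ∧ (i + 1) % m = i % m + 1) ∨ (i % m + 1 = m ∧ (i + 1) % m = 0) := by
  have := Nat.mod_lt i (show m > 0 by omega)
  have h : (i + 1) % m = (i % m + 1) % m := by simp
  rcases Nat.lt_or_ge (i % m + 1) m with h' | h'
  · left
    exact ⟨h', by rw [h, Nat.mod_eq_of_lt h']⟩
  · right
    have : i % m + 1 = m := by omega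
    exact ⟨this, by rw [h, this, Nat.mod_self]⟩

lemma fg_disjoint (m i j : ℕ) (hm : 6 ≤ m) (hm2 : m % 2 = 0) :
    ¬ ((i % m = gmap m j ∧ (i + 1) % m = gmap m (j + 1)) ∨
      (i % m = gmap m (j + 1) ∧ (i + 1) % m = gmap m j)) := by
  have h1 := succ_mod_cases m i hm
  have h2 := succ_mod_cases m j hm
  have := Nat.mod_lt i (show m > 0 by omega)
  have := Nat.mod_lt j (show m > 0 by omega)
  unfold gmap
  generalize (j + 1) % m = j' at *
  generalize (i + 1) % m = i' at *
  generalize i % m = i at *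
  generalize j % m = j at *
  split_ifs <;> omega

/-- Coverage of a cycle by consecutive indices. -/
lemma cover_mod (m a t : ℕ) (hm : 0 < m) : ∃ i, i < m ∧ (a + i) % m = t % m := by
  refine ⟨(t + (m - a % m)) % m, Nat.mod_lt _ hm, ?_⟩
  have h1 := Nat.mod_lt a hm
  have h2 := Nat.div_add_mod a m
  rw [Nat.add_mod_mod]
  have : a + (t + (m - a % m)) = t + m * (a / m + 1) := by
    rw [mul_add]; omega
  rw [this, Nat.add_mul_mod_self_left]

lemma inj_mod (m a i j : ℕ) (hi : i < m) (hj : j < m) (h : (a + i) % m = (a + j) % m) :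
    i = j := by
  have h4 := Nat.ModEq.add_left_cancel' (c := a) (n := m) (a := i) (b := j) h
  unfold Nat.ModEq at h4
  rwa [Nat.mod_eq_of_lt hi, Nat.mod_eq_of_lt hj] at h4

lemma color_ne {x y : Fin 2} {a b : ℕ} (hx : x = 0 ↔ a % 2 = 0) (hy : y = 0 ↔ b % 2 = 0)
    (hab : b = a + 1) : x ≠ y := by
  rintro rfl
  have := hx.symm.trans hy
  omega

/-- The even case. -/
lemma good_even {V : Type*} (m : ℕ) (hm : 6 ≤ m) (f g : ℕ → V)
    (hf : ∀ i j, f i = f j ↔ i % m = j % m) (hg : ∀ i j, g i = g j ↔ i % m = j % m)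
    (hd : ∀ i j, s(f i, f (i + 1)) ≠ s(g j, g (j + 1)))
    (hfs : ∀ x, ∃ i, f i = x) (hgs : ∀ x, ∃ i, g i = x) (c : Sym2 V → Fin 2)
    (hcf : ∀ i, c s(f i, f (i + 1)) = 0 ↔ i % 2 = 0)
    (hcg : ∀ i, c s(g i, g (i + 1)) = 0 ↔ i % 2 = 0) (v : V) : GoodAt c v := by
  obtain ⟨j, rfl⟩ := hfs v
  refine ⟨fun i => f (j + 1 + i), g, m - 2, m - 1, ?_, ?_, ?_, ?_, ?_, ?_, ?_⟩
  · intro a b ha hb h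
    exact inj_mod m (j + 1) a b (by omega) (by omega) ((hf _ _).1 h)
  · intro a b ha hb h
    exact inj_mod m 0 a b (by omega) (by omega) (by simpa using (hg _ _).1 h)
  · intro i _
    exact color_ne (hcf (j + 1 + i)) (hcf (j + 1 + i + 1)) rfl
  · intro i _
    exact color_ne (hcg i) (hcg (i + 1)) rfl
  · intro x
    constructor
    · rintro ⟨i, hi, rfl⟩ h
      have h1 : (j + (1 + i)) % m = (j + 0) % m := by
        rw [← add_assoc]; exact (hf _ _).1 h
      have := inj_mod m j (1 + i) 0 (by omega) (by omega) h1
      omega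
    · intro hx
      obtain ⟨t, rfl⟩ := hfs x
      obtain ⟨i, hi, h⟩ := cover_mod m (j + 1) t (by omega)
      refine ⟨i, ?_, (hf _ _).2 h⟩
      by_contra h'
      apply hx
      rw [hf, ← h, show j + 1 + i = j + m by omega, Nat.add_mod_right]
  · intro x _
    obtain ⟨t, rfl⟩ := hgs x
    exact ⟨t % m, by have := Nat.mod_lt t (show m > 0 by omega); omega, by rw [hg]; simp⟩
  · intro a b _ _
    exact hd _ _

/-- Prepend a vertex to a sequence. -/
def consSeq {V : Type*} (w : V) (f : ℕ → V) : ℕ → V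
  | 0 => w
  | i + 1 => f i

/-- The odd case. -/
lemma good_odd {V : Type*} (m : ℕ) (hm : 6 ≤ m) (f g : ℕ → V) (w : V)
    (hf : ∀ i j, f i = f j ↔ i % m = j % m) (hg : ∀ i j, g i = g j ↔ i % m = j % m)
    (hd : ∀ i j, s(f i, f (i + 1)) ≠ s(g j, g (j + 1)))
    (hfw : ∀ i, f i ≠ w) (hgw : ∀ i, g i ≠ w)
    (hfs : ∀ x, x ≠ w → ∃ i, f i = x) (hgs : ∀ x, x ≠ w → ∃ i, g i = x) (c : Sym2 V → Fin 2)
    (hcf : ∀ i, c s(f i, f (i + 1)) = 0 ↔ i % 2 = 0)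
    (hcg : ∀ i, c s(g i, g (i + 1)) = 0 ↔ i % 2 = 0)
    (hcw : ∀ i, c s(w, f i) = 0 ↔ (i + 1) % 2 = 0)
    (hg0 : g 0 = f 0) (hg2 : g 2 = f 4) (v : V) : GoodAt c v := by
  by_cases hv : v = w
  · subst hv
    refine ⟨f, g, m - 1, m - 1, ?_, ?_, ?_, ?_, ?_, ?_, ?_⟩
    · intro a b ha hb h
      exact inj_mod m 0 a b (by omega) (by omega) (by simpa using (hf _ _).1 h)
    · intro a b ha hb h
      exact inj_mod m 0 a b (by omega) (by omega) (by simpa using (hg _ _).1 h)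
    · intro i _
      exact color_ne (hcf i) (hcf (i + 1)) rfl
    · intro i _
      exact color_ne (hcg i) (hcg (i + 1)) rfl
    · intro x
      constructor
      · rintro ⟨i, hi, rfl⟩
        exact hfw i
      · intro hx
        obtain ⟨t, rfl⟩ := hfs x hx
        exact ⟨t % m, by have := Nat.mod_lt t (show m > 0 by omega); omega, by rw [hf]; simp⟩
    · intro x hx
      obtain ⟨t, rfl⟩ := hgs x hx
      exact ⟨t % m, by have := Nat.mod_lt t (show m > 0 by omega); omega, by rw [hg]; simp⟩
    · intro a b _ _
      exact hd _ _
  · obtain ⟨j, rfl⟩ := hfs v hv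
    obtain ⟨a, ha1, ha2, ha3⟩ : ∃ a, a % 2 = 0 ∧ g a ≠ f (j + 1) ∧
        (c s(w, g a) = 0 ↔ (a + 1) % 2 = 0) := by
      by_cases h : g 0 = f (j + 1)
      · refine ⟨2, rfl, ?_, ?_⟩
        · intro h'
          have := (hg _ _).1 (h.trans h'.symm)
          rw [Nat.zero_mod, Nat.mod_eq_of_lt (by omega)] at this
          omega
        · rw [hg2, hcw]
      · exact ⟨0, rfl, h, by rw [hg0, hcw]⟩
    refine ⟨consSeq w (fun i => f (j + 1 + i)), consSeq w (fun i => g (a + i)), m - 1, m,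
      ?_, ?_, ?_, ?_, ?_, ?_, ?_⟩
    · rintro (_ | x) (_ | y) hx hy h
      · rfl
      · exact absurd h.symm (hfw _)
      · exact absurd h (hfw _)
      · have := inj_mod m (j + 1) x y (by omega) (by omega) ((hf _ _).1 h)
        omega
    · rintro (_ | x) (_ | y) hx hy h
      · rfl
      · exact absurd h.symm (hgw _)
      · exact absurd h (hgw _)
      · have := inj_mod m a x y (by omega) (by omega) ((hg _ _).1 h)
        omega
    · rintro (_ | i) _
      · have h1 := hcw (j + 1)
        have h2 := hcf (j + 1)
        change c s(w, f (j + 1)) ≠ c s(f (j + 1), f (j + 1 + 1))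
        exact (color_ne h2 h1 rfl).symm
      · exact color_ne (hcf (j + 1 + i)) (hcf (j + 1 + i + 1)) rfl
    · rintro (_ | i) _
      · change c s(w, g a) ≠ c s(g a, g (a + 1))
        exact (color_ne (hcg a) ha3 rfl).symm
      · exact color_ne (hcg (a + i)) (hcg (a + i + 1)) rfl
    · intro x
      constructor
      · rintro ⟨_ | i, hi, rfl⟩ h
        · exact hv h.symm
        · have h1 : (j + (1 + i)) % m = (j + 0) % m := by
            rw [← add_assoc]; exact (hf _ _).1 h
          have := inj_mod m j (1 + i) 0 (by omega) (by omega) h1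
          omega
      · intro hx
        by_cases hxw : x = w
        · exact ⟨0, by omega, hxw.symm⟩
        obtain ⟨t, rfl⟩ := hfs x hxw
        obtain ⟨i, hi, h⟩ := cover_mod m (j + 1) t (by omega)
        refine ⟨i + 1, ?_, (hf _ _).2 h⟩
        by_contra h'
        apply hx
        rw [hf, ← h, show j + 1 + i = j + m by omega, Nat.add_mod_right]
    · intro x hx
      by_cases hxw : x = w
      · exact ⟨0, by omega, hxw.symm⟩
      obtain ⟨t, rfl⟩ := hgs x hxw
      obtain ⟨i, hi, h⟩ := cover_mod m a t (by omega)
      exact ⟨i + 1, by omega, (hg _ _).2 h⟩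
    · rintro (_ | x) (_ | y) _ _ h
      · change s(w, f (j + 1)) = s(w, g a) at h
        rw [Sym2.eq_iff] at h
        rcases h with h | h
        · exact ha2 h.2.symm
        · exact hgw _ h.1.symm
      · change s(w, f (j + 1)) = s(g (a + y), g (a + y + 1)) at h
        rw [Sym2.eq_iff] at h
        rcases h with h | h
        · exact hgw _ h.1.symm
        · exact hgw _ h.1.symm
      · change s(f (j + 1 + x), f (j + 1 + x + 1)) = s(w, g a) at h
        rw [Sym2.eq_iff] at h
        rcases h with h | h
        · exact hfw _ h.1
        · exact hfw _ h.2
      · exact hd _ _ h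

lemma gmap_surj (m x : ℕ) (hm : 6 ≤ m) (hm2 : m % 2 = 0) (hx : x < m) : ∃ i, gmap m i = x := by
  rcases Nat.mod_two_eq_zero_or_one x with h | h
  · refine ⟨x / 2, ?_⟩
    unfold gmap
    rw [Nat.mod_eq_of_lt (by omega)]
    split_ifs <;> omega
  · by_cases h1 : x = 1
    · refine ⟨m / 2, ?_⟩
      unfold gmap
      rw [Nat.mod_eq_of_lt (by omega)]
      split_ifs <;> omega
    · refine ⟨m - x / 2, ?_⟩
      unfold gmap
      rw [Nat.mod_eq_of_lt (by omega)]
      split_ifs <;> omega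

lemma px_even (n : ℕ) (hn : 6 ≤ n) (hn2 : n % 2 = 0) :
    pxLE (⊤ : SimpleGraph (Fin n)) (n - 1) 2 2 := by
  let f : ℕ → Fin n := fun i => ⟨i % n, Nat.mod_lt _ (by omega)⟩
  let g : ℕ → Fin n := fun i => ⟨gmap n i, gmap_lt n i hn hn2⟩
  have hf : ∀ i j, f i = f j ↔ i % n = j % n := by
    intro i j
    simp [f]
  have hg : ∀ i j, g i = g j ↔ i % n = j % n := by
    intro i j
    simp only [g, Fin.mk.injEq]
    exact gmap_eq_iff n i j hn hn2
  have hd : ∀ i j, s(f i, f (i + 1)) ≠ s(g j, g (j + 1)) := by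
    intro i j h
    simp only [f, g, Sym2.eq_iff, Fin.mk.injEq] at h
    exact fg_disjoint n i j hn hn2 h
  obtain ⟨c, h1, h2, -⟩ := exists_coloring n hn hn2 f g hf hg hd ∅ (by simp) (by simp)
  refine ⟨c, proper_of_goodAt (by omega) c (good_even n hn f g hf hg hd ?_ ?_ c h1 h2)⟩
  · intro x
    exact ⟨x, by ext; simp [f, Nat.mod_eq_of_lt x.2]⟩
  · intro x
    obtain ⟨i, hi⟩ := gmap_surj n x hn hn2 x.2
    exact ⟨i, Fin.ext hi⟩

lemma px_odd (m : ℕ) (hm : 6 ≤ m) (hm2 : m % 2 = 0) :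
    pxLE (⊤ : SimpleGraph (Fin (m + 1))) (m + 1 - 1) 2 2 := by
  have hlt : ∀ i, i % m < m := fun i => Nat.mod_lt _ (by omega)
  have hglt : ∀ i, gmap m i < m := fun i => gmap_lt m i hm hm2
  let f : ℕ → Fin (m + 1) := fun i => ⟨i % m, (hlt i).trans (by omega)⟩
  let g : ℕ → Fin (m + 1) := fun i => ⟨gmap m i, (hglt i).trans (by omega)⟩
  let w : Fin (m + 1) := ⟨m, by omega⟩
  have hf : ∀ i j, f i = f j ↔ i % m = j % m := by
    intro i j
    simp [f]
  have hg : ∀ i j, g i = g j ↔ i % m = j % m := by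
    intro i j
    simp only [g, Fin.mk.injEq]
    exact gmap_eq_iff m i j hm hm2
  have hd : ∀ i j, s(f i, f (i + 1)) ≠ s(g j, g (j + 1)) := by
    intro i j h
    simp only [f, g, Sym2.eq_iff, Fin.mk.injEq] at h
    exact fg_disjoint m i j hm hm2 h
  have hfw : ∀ i, f i ≠ w := fun i h => (hlt i).ne (congrArg Fin.val h)
  have hgw : ∀ i, g i ≠ w := fun i h => (hglt i).ne (congrArg Fin.val h)
  have hwf : ∀ x i, s(w, x) ≠ s(f i, f (i + 1)) := by
    intro x i h
    rw [Sym2.eq_iff] at h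
    rcases h with h | h
    · exact hfw _ h.1.symm
    · exact hfw _ h.1.symm
  have hwg : ∀ x i, s(w, x) ≠ s(g i, g (i + 1)) := by
    intro x i h
    rw [Sym2.eq_iff] at h
    rcases h with h | h
    · exact hgw _ h.1.symm
    · exact hgw _ h.1.symm
  obtain ⟨c, h1, h2, h3⟩ := exists_coloring m hm hm2 f g hf hg hd
    {e | ∃ i, (i + 1) % 2 = 0 ∧ s(w, f i) = e}
    (by rintro i ⟨t, -, h⟩; exact hwf _ _ h) (by rintro i ⟨t, -, h⟩; exact hwg _ _ h)
  have hlt' : ∀ x : Fin (m + 1), x ≠ w → (x : ℕ) < m := by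
    intro x hx
    have : (x : ℕ) ≠ m := fun h => hx (Fin.ext h)
    have := x.2
    omega
  refine ⟨c, proper_of_goodAt (by omega) c
    (good_odd m hm f g w hf hg hd hfw hgw ?_ ?_ c h1 h2 ?_ ?_ ?_)⟩
  · intro x hx
    exact ⟨x, by ext; simp [f, Nat.mod_eq_of_lt (hlt' x hx)]⟩
  · intro x hx
    obtain ⟨i, hi⟩ := gmap_surj m x hm hm2 (hlt' x hx)
    exact ⟨i, Fin.ext hi⟩
  · intro i
    rw [h3 _ (hwf _) (hwg _)]
    constructor
    · rintro ⟨t, ht, h⟩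
      rw [Sym2.eq_iff] at h
      rcases h with h | h
      · have := par_mod m hm2 _ _ ((hf _ _).1 h.2)
        omega
      · exact absurd h.2 (hfw _)
    · intro h
      exact ⟨i, h, rfl⟩
  · apply Fin.ext
    change gmap m 0 = 0 % m
    unfold gmap
    simp
    omega
  · apply Fin.ext
    change gmap m 2 = 4 % m
    unfold gmap
    rw [Nat.mod_eq_of_lt (show 2 < m by omega), Nat.mod_eq_of_lt (show 4 < m by omega),
      if_pos (by omega)]

/-- The small cases are checked by explicit paths given as functions on `Fin`. -/
lemma goodAt_of_fin {n k l : ℕ} (c : Sym2 (Fin n) → Fin 2) (v : Fin n)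
    (p : Fin (k + 1) → Fin n) (q : Fin (l + 1) → Fin n)
    (h1 : ∀ i j, p i = p j → i = j) (h2 : ∀ i j, q i = q j → i = j)
    (h3 : ∀ i j t : Fin (k + 1), i.val + 1 = j.val → j.val + 1 = t.val →
      c s(p i, p j) ≠ c s(p j, p t))
    (h4 : ∀ i j t : Fin (l + 1), i.val + 1 = j.val → j.val + 1 = t.val →
      c s(q i, q j) ≠ c s(q j, q t))
    (h5 : ∀ x, (∃ i, p i = x) ↔ x ≠ v) (h6 : ∀ x, x ≠ v → ∃ i, q i = x)
    (h7 : ∀ i j : Fin (k + 1), i.val + 1 = j.val → ∀ a b : Fin (l + 1), a.val + 1 = b.val →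
      s(p i, p j) ≠ s(q a, q b)) : GoodAt c v := by
  have hk : ∀ i, i ≤ k → (Fin.ofNat (k + 1) i).val = i := fun i hi =>
    Nat.mod_eq_of_lt (by omega)
  have hl : ∀ i, i ≤ l → (Fin.ofNat (l + 1) i).val = i := fun i hi =>
    Nat.mod_eq_of_lt (by omega)
  refine ⟨fun i => p (Fin.ofNat (k + 1) i), fun i => q (Fin.ofNat (l + 1) i), k, l,
    ?_, ?_, ?_, ?_, ?_, ?_, ?_⟩
  · intro i j hi hj h
    have := congrArg Fin.val (h1 _ _ h)
    rwa [hk i hi, hk j hj] at this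
  · intro i j hi hj h
    have := congrArg Fin.val (h2 _ _ h)
    rwa [hl i hi, hl j hj] at this
  · intro i hi
    apply h3 <;> rw [hk _ (by omega), hk _ (by omega)]
  · intro i hi
    apply h4 <;> rw [hl _ (by omega), hl _ (by omega)]
  · intro x
    rw [← h5 x]
    constructor
    · rintro ⟨i, -, h⟩
      exact ⟨_, h⟩
    · rintro ⟨i, h⟩
      exact ⟨i, by omega, by rw [← h]; exact congrArg p (Fin.ext (hk i.val (by omega)))⟩
  · intro x hx
    obtain ⟨i, h⟩ := h6 x hx
    exact ⟨i, by omega, by rw [← h]; exact congrArg q (Fin.ext (hl i.val (by omega)))⟩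
  · intro i j hi hj
    apply h7
    · rw [hk _ (by omega), hk _ (by omega)]
    · rw [hl _ (by omega), hl _ (by omega)]

/-- Coloring for `n = 4`: a red path and its complement. -/
def c4 (e : Sym2 (Fin 4)) : Fin 2 :=
  if e = s(0, 1) ∨ e = s(1, 2) ∨ e = s(2, 3) then 0 else 1

/-- Coloring for `n = 5`. -/
def c5 (e : Sym2 (Fin 5)) : Fin 2 :=
  if e = s(1, 3) ∨ e = s(1, 4) ∨ e = s(2, 3) ∨ e = s(2, 4) then 0 else 1

lemma px_four : pxLE (⊤ : SimpleGraph (Fin 4)) (4 - 1) 2 2 := by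
  refine ⟨c4, proper_of_goodAt (by omega) c4 ?_⟩
  intro v
  fin_cases v
  · exact goodAt_of_fin (k := 2) (l := 3) c4 0 ![2, 1, 3] ![3, 2, 0, 1] (by decide) (by decide)
      (by decide) (by decide) (by decide) (by decide) (by decide)
  · exact goodAt_of_fin (k := 2) (l := 3) c4 1 ![0, 3, 2] ![2, 0, 1, 3] (by decide) (by decide)
      (by decide) (by decide) (by decide) (by decide) (by decide)
  · exact goodAt_of_fin (k := 2) (l := 3) c4 2 ![3, 0, 1] ![1, 3, 2, 0] (by decide) (by decide)
      (by decide) (by decide) (by decide) (by decide) (by decide)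
  · exact goodAt_of_fin (k := 2) (l := 3) c4 3 ![1, 2, 0] ![0, 1, 3, 2] (by decide) (by decide)
      (by decide) (by decide) (by decide) (by decide) (by decide)

set_option maxRecDepth 4000 in
lemma px_five : pxLE (⊤ : SimpleGraph (Fin 5)) (5 - 1) 2 2 := by
  refine ⟨c5, proper_of_goodAt (by omega) c5 ?_⟩
  intro v
  fin_cases v
  · exact goodAt_of_fin (k := 3) (l := 4) c5 0 ![1, 3, 4, 2] ![0, 3, 2, 1, 4] (by decide)
      (by decide) (by decide) (by decide) (by decide) (by decide) (by decide)
  · exact goodAt_of_fin (k := 3) (l := 4) c5 1 ![0, 2, 3, 4] ![0, 3, 1, 2, 4] (by decide)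
      (by decide) (by decide) (by decide) (by decide) (by decide) (by decide)
  · exact goodAt_of_fin (k := 3) (l := 4) c5 2 ![0, 1, 3, 4] ![0, 3, 2, 1, 4] (by decide)
      (by decide) (by decide) (by decide) (by decide) (by decide) (by decide)
  · exact goodAt_of_fin (k := 3) (l := 4) c5 3 ![0, 4, 1, 2] ![0, 1, 3, 4, 2] (by decide)
      (by decide) (by decide) (by decide) (by decide) (by decide) (by decide)
  · exact goodAt_of_fin (k := 3) (l := 4) c5 4 ![0, 3, 1, 2] ![0, 1, 4, 3, 2] (by decide)
      (by decide) (by decide) (by decide) (by decide) (by decide) (by decide)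

/-- For every `n ≥ 4`, `px_{n-1,2}(K_n) = 2`. -/
theorem px_nsub1_2_complete (n : ℕ) (hn : 4 ≤ n) :
    pxEq2 (⊤ : SimpleGraph (Fin n)) (n - 1) 2 := by
  refine ⟨?_, not_pxLE_one n hn⟩
  by_cases h4 : n = 4
  · subst h4
    exact px_four
  by_cases h5 : n = 5
  · subst h5
    exact px_five
  rcases Nat.mod_two_eq_zero_or_one n with h | h
  · exact px_even n (by omega) h
  · obtain ⟨m, rfl⟩ : ∃ m, n = m + 1 := ⟨n - 1, by omega⟩
    exact px_odd m (by omega) (by omega)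
end
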